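/- Two quaternions are conjugate (similar) if and only if they have the same norm and the same real part. That is, for quaternions a and b, there exists a nonzero quaternion p with a = p·b·p⁻¹ if and only if |a| = |b| and Re(a) = Re(b). -/

import Mathlib

open Quaternion

theorem Quaternion.re_mul_comm {R : Type*} [CommRing R] (a b : ℍ[R]) :
    (a * b).re = (b * a).re := by
  simp only [Quaternion.re_mul]
  ring

theorem Quaternion.norm_eq_norm_iff_normSq_eq (a b : ℍ[ℝ]) :
    ‖a‖ = ‖b‖ ↔ normSq a = normSq b := by
  rw [normSq_eq_norm_mul_self, normSq_eq_norm_mul_self,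
    mul_self_inj (norm_nonneg a) (norm_nonneg b)]

/-- A nonzero quaternion anticommuting with a given pure quaternion. -/
theorem Quaternion.exists_ne_zero_mul_eq_neg_mul {R : Type*} [CommRing R] [Nontrivial R]
    {u : ℍ[R]} (hu : u.re = 0) : ∃ p : ℍ[R], p ≠ 0 ∧ u * p = -(p * u) := by
  obtain ⟨p, hp, hre, hK, hIJ⟩ : ∃ p : ℍ[R], p ≠ 0 ∧ p.re = 0 ∧ p.imK = 0 ∧
      u.imI * p.imI + u.imJ * p.imJ = 0 := by
    by_cases h : u.imI = 0 ∧ u.imJ = 0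
    · exact ⟨⟨0, 1, 0, 0⟩, fun h0 => one_ne_zero (congrArg QuaternionAlgebra.imI h0), rfl, rfl,
        by rw [h.1, h.2, zero_mul, zero_mul, zero_add]⟩
    · refine ⟨⟨0, -u.imJ, u.imI, 0⟩, fun h0 => h ⟨?_, ?_⟩, rfl, rfl, by ring⟩
      · exact congrArg QuaternionAlgebra.imJ h0
      · exact neg_eq_zero.mp (congrArg QuaternionAlgebra.imI h0)
  refine ⟨p, hp, ?_⟩
  apply Quaternion.ext
  · simp only [re_neg, re_mul, hu, hre, hK]
    linear_combination -2 * hIJ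
  all_goals
    simp only [imI_neg, imJ_neg, imK_neg, imI_mul, imJ_mul, imK_mul, hu, hre, hK]
    ring

theorem Quaternion.mul_eq_mul_of_re_eq {R : Type*} [CommRing R] {a b p : ℍ[R]}
    (hr : a.re = b.re) (h : a.im * p = p * b.im) : a * p = p * b := by
  rw [← re_add_im a, ← re_add_im b, add_mul, mul_add, h, hr, coe_commutes]

/-- Quaternions with equal norm and equal real part are intertwined by a nonzero quaternion. -/
theorem Quaternion.exists_ne_zero_mul_eq_mul {R : Type*} [CommRing R] [Nontrivial R]
    {a b : ℍ[R]} (hn : normSq a = normSq b) (hr : a.re = b.re) :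
    ∃ p : ℍ[R], p ≠ 0 ∧ a * p = p * b := by
  by_cases h : a.im + b.im = 0
  · obtain ⟨p, hp, hup⟩ := exists_ne_zero_mul_eq_neg_mul (re_im a)
    refine ⟨p, hp, mul_eq_mul_of_re_eq hr ?_⟩
    rw [hup, eq_neg_of_add_eq_zero_right h, mul_neg]
  · refine ⟨a.im + b.im, h, mul_eq_mul_of_re_eq hr ?_⟩
    have hsq : a.im * a.im = b.im * b.im := by
      rw [← sq, ← sq, im_sq, im_sq]
      congr 2
      simp only [normSq_def'] at hn ⊢
      simp only [re_im, imI_im, imJ_im, imK_im]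
      linear_combination hn - (a.re + b.re) * hr
    rw [mul_add, add_mul, hsq, add_comm]

theorem quaternion_conjugate_iff_same_norm_and_re (a b : ℍ[ℝ]) :
    (∃ p : ℍ[ℝ], p ≠ 0 ∧ a = p * b * p⁻¹) ↔ (‖a‖ = ‖b‖ ∧ a.re = b.re) := by
  constructor
  · rintro ⟨p, hp, rfl⟩
    refine ⟨?_, ?_⟩
    · rw [norm_mul, norm_mul, norm_inv, mul_right_comm,
        mul_inv_cancel₀ (norm_ne_zero_iff.mpr hp), one_mul]
    · rw [re_mul_comm, inv_mul_cancel_left₀ hp]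
  · rintro ⟨hn, hr⟩
    obtain ⟨p, hp, h⟩ := exists_ne_zero_mul_eq_mul ((norm_eq_norm_iff_normSq_eq a b).mp hn) hr
    exact ⟨p, hp, (eq_mul_inv_iff_mul_eq₀ hp).mpr h⟩
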